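/- arXiv:1806.07648 — 2 statements merged into one kernel-verified Lean document; each statement's English description precedes it below -/
import Mathlib

section
/- Let Q be the degree-27 polynomial given by 2^{10} · det M(k)/ ∏_{j=1}^{10} (2j)!, where M(k) is the 10 × 10 matrix with M_{0,s} = 1 and M_{r,s} = (k+1+r)^{2s+2} - (k+1-r)^{2s+2} for 1 ≤ r ≤ 9, 0 ≤ s ≤ 9. Then Q has a complex root with strictly positive real part. -/
/-- The genus-`g` Verlinde matrix over ℂ: `M_{0,s} = 1` and
`M_{r,s} = (k+1+r)^{2s+2} - (k+1-r)^{2s+2}` for `r ≥ 1`. -/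
def verlindeMatrix (g : ℕ) (k : ℂ) : Matrix (Fin g) (Fin g) ℂ :=
  fun r s => if (r : ℕ) = 0 then 1
    else (k + 1 + (r : ℕ)) ^ (2 * (s : ℕ) + 2) - (k + 1 - (r : ℕ)) ^ (2 * (s : ℕ) + 2)

/-- `Q(k) = 2^g det M(k) / ∏_{j=1}^g (2j)!`, the Verlinde/Hilbert polynomial of the
genus-`g` moduli space `M_C(2,L)`, viewed as a function on ℂ. -/
noncomputable def Q (g : ℕ) (k : ℂ) : ℂ :=
  2 ^ g * (verlindeMatrix g k).det /
    (∏ j ∈ Finset.Icc 1 g, (Nat.factorial (2 * j) : ℂ))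

/-- kernel vector -/
def kerVec (y : ℂ) : Fin 10 → ℂ :=
  ![(-55306395648000 + y * (-85159003345920 + y * (-83168251387200 + y * (-65484271828640 + y * (-43768456133220 + y * (-24661047383700 + y * (-11312251517960 + y * (-3966952084200 + y * (-945775547220 + y * (-114993831140)))))))))),
    (42579501672960 + y * (59405893848000 + y * (51753698703280 + y * (35612129662200 + y * (20225919683970 + y * (9297270437000 + y * (3262095146940 + y * (777833742000 + y * (94577554722))))))))),
    (-11881178769600 + y * (-14786771058080 + y * (-11258028086760 + y * (-6582714017880 + y * (-3050086919880 + y * (-1072415362200 + y * (-255850599760 + y * (-31113349680)))))))),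
    (1584296899080 + y * (1723167564300 + y * (1114814470770 + y * (531792432600 + y * (188474676390 + y * (45059469000 + y * (5482512852))))))),
    (-114877837620 + y * (-106172806740 + y * (-56038342360 + y * (-20446946520 + y * (-4927442520 + y * (-600792920)))))),
    (4826036670 + y * (3638853400 + y * (1469062140 + y * (364473200 + y * (44794932))))),
    (-119962200 + y * (-69186600 + y * (-18992400 + y * (-2403120)))),
    (1729665 + y * (678300 + y * (94962))),
    (-13300 + y * (-2660)),
    (42)]

/-- the reduced polynomial in `(k+1)^2` -/
noncomputable def redF (y : ℂ) : ℂ :=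
  (-23133945892303 + y * (-38919315456000 + y * (-41612354477568 + y * (-35943148628160 + y * (-26409031340328 + y * (-16391733632820 + y * (-8300524457928 + y * (-3220231691880 + y * (-851197992498 + y * (-114993831140))))))))))

open Polynomial in
/-- the reduced polynomial in `k` -/
noncomputable def redP : Polynomial ℂ :=
  C (-23133945892303) * ((X + 1) ^ 2) ^ 0+C (-38919315456000) * ((X + 1) ^ 2) ^ 1+C (-41612354477568) * ((X + 1) ^ 2) ^ 2+C (-35943148628160) * ((X + 1) ^ 2) ^ 3+C (-26409031340328) * ((X + 1) ^ 2) ^ 4+C (-16391733632820) * ((X + 1) ^ 2) ^ 5+C (-8300524457928) * ((X + 1) ^ 2) ^ 6+C (-3220231691880) * ((X + 1) ^ 2) ^ 7+C (-851197992498) * ((X + 1) ^ 2) ^ 8+C (-114993831140) * ((X + 1) ^ 2) ^ 9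

lemma redP_eval (k : ℂ) : redP.eval k = redF ((k + 1) ^ 2) := by
  simp only [redP, redF, Polynomial.eval_add, Polynomial.eval_mul, Polynomial.eval_C,
    Polynomial.eval_pow, Polynomial.eval_X, Polynomial.eval_one]
  ring

lemma kerVec_sum (y : ℂ) : ∑ s, kerVec y s = redF y := by
  simp [kerVec, redF, Fin.sum_univ_succ]
  ring

lemma row_zero (x : ℂ) (r : ℕ) (h1 : 1 ≤ r) (h2 : r ≤ 9) :
    ∑ s : Fin 10, ((x + (r : ℂ)) ^ (2 * (s : ℕ) + 2) - (x - (r : ℂ)) ^ (2 * (s : ℕ) + 2))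
      * kerVec (x ^ 2) s = 0 := by
  interval_cases r <;> simp [Fin.sum_univ_succ, kerVec] <;> ring


lemma det_zero (k : ℂ) (h : redF ((k + 1) ^ 2) = 0) : (verlindeMatrix 10 k).det = 0 := by
  apply Matrix.exists_mulVec_eq_zero_iff.mp
  refine ⟨kerVec ((k + 1) ^ 2), ?_, ?_⟩
  · intro h0
    have := congrFun h0 9
    simp [kerVec] at this
  · funext r
    simp only [Matrix.mulVec, dotProduct, verlindeMatrix, Pi.zero_apply]
    by_cases hr : (r : ℕ) = 0
    · simp only [hr, if_true, one_mul]
      rw [kerVec_sum, h]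
    · simp only [hr, if_false]
      exact row_zero (k + 1) r (by omega) (by omega)

lemma norm_le_of_roots (p : Polynomial ℂ) (hp : ∀ a ∈ p.roots, a.re ≤ 0) (z w : ℂ)
    (hz : 0 < z.re) (hw : w.re = -z.re) (hi : w.im = z.im) :
    ‖p.eval w‖ ≤ ‖p.eval z‖ := by
  have key : ∀ t : ℂ, ‖p.eval t‖ = ‖p.leadingCoeff‖ * (p.roots.map (fun a => ‖t - a‖)).prod := by
    intro t
    have h := (IsAlgClosed.splits p).eq_prod_roots
    conv_lhs => rw [h]
    rw [Polynomial.eval_mul, Polynomial.eval_C, norm_mul, Polynomial.eval_multiset_prod,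
      Multiset.map_map]
    congr 1
    have hm := map_multiset_prod (normHom : ℂ →*₀ ℝ) (p.roots.map (Polynomial.eval t ∘ fun a => Polynomial.X - Polynomial.C a))
    rw [Multiset.map_map] at hm
    simpa [Function.comp_def, normHom] using hm
  rw [key, key]
  refine mul_le_mul_of_nonneg_left ?_ (norm_nonneg _)
  apply Multiset.prod_map_le_prod_map₀
  · intro a _; exact norm_nonneg _
  · intro a ha
    have := hp a ha
    rw [Complex.norm_def, Complex.norm_def]
    apply Real.sqrt_le_sqrt
    simp only [Complex.normSq_apply, Complex.sub_re, Complex.sub_im, hw, hi]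
    nlinarith

lemma exists_root : ∃ z : ℂ, redF ((z + 1) ^ 2) = 0 ∧ 0 < z.re := by
  by_contra hcon
  push Not at hcon
  have h := norm_le_of_roots redP (fun a ha => by
    apply hcon
    rw [← redP_eval]
    exact (Polynomial.mem_roots'.mp ha).2) ⟨1/50, 33/50⟩ ⟨-1/50, 33/50⟩ (by norm_num)
    (by norm_num) rfl
  rw [redP_eval, redP_eval] at h
  have h2 := pow_le_pow_left₀ (norm_nonneg _) h 2
  rw [← Complex.normSq_eq_norm_sq, ← Complex.normSq_eq_norm_sq] at h2
  have e1 : ((⟨1/50, 33/50⟩ : ℂ) + 1) ^ 2 = ⟨(51/50)^2 - (33/50)^2, 2*(51/50)*(33/50)⟩ := by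
    apply Complex.ext <;> norm_num [pow_two]
  have e2 : ((⟨-1/50, 33/50⟩ : ℂ) + 1) ^ 2 = ⟨(49/50)^2 - (33/50)^2, 2*(49/50)*(33/50)⟩ := by
    apply Complex.ext <;> norm_num [pow_two]
  rw [e1, e2] at h2
  simp only [redF, Complex.normSq_apply, Complex.add_re, Complex.add_im, Complex.mul_re,
    Complex.mul_im, Complex.neg_re, Complex.neg_im, Complex.re_ofNat, Complex.im_ofNat] at h2
  norm_num at h2

theorem genus_ten_violates_canonical_strip :
    ∃ z : ℂ, Q 10 z = 0 ∧ 0 < z.re := by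
  obtain ⟨z, hz, hre⟩ := exists_root
  refine ⟨z, ?_, hre⟩
  rw [Q, det_zero z hz]
  simp
end

section
/- Let Q be the degree-21 polynomial 2^8 · det M(k)/∏_{j=1}^{8}(2j)!, where M(k) is the 8 × 8 matrix with M_{0,s} = 1 and M_{r,s} = (k+1+r)^{2s+2} - (k+1-r)^{2s+2} for 1 ≤ r ≤ 7, 0 ≤ s ≤ 7. Then Q has a complex root whose real part is strictly greater than -2/22 = -1/11. -/
open Polynomial in
/-- The reduced polynomial in `t = k + 1`. -/
noncomputable def redPoly : ℂ[X] :=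
  C (257184319:ℂ) * X^0 + C (435456000:ℂ) * X^2 + C (454603968:ℂ) * X^4 + C (367407040:ℂ) * X^6 + C (237218982:ℂ) * X^8 + C (117182520:ℂ) * X^10 + C (39605356:ℂ) * X^12 + C (6880440:ℂ) * X^14

theorem redPoly_eval (t : ℂ) : redPoly.eval t = (((((((6880440) * (t*t) + 39605356) * (t*t) + 117182520) * (t*t) + 237218982) * (t*t) + 367407040) * (t*t) + 454603968) * (t*t) + 435456000) * (t*t) + 257184319 := by
  simp only [redPoly, Polynomial.eval_add, Polynomial.eval_mul, Polynomial.eval_C,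
    Polynomial.eval_pow, Polynomial.eval_X]
  ring

theorem redPoly_natDegree : redPoly.natDegree = 14 := by
  unfold redPoly
  compute_degree!

theorem redPoly_lc : redPoly.leadingCoeff = 6880440 := by
  rw [Polynomial.leadingCoeff, redPoly_natDegree]
  unfold redPoly
  simp [Polynomial.coeff_X_pow]

theorem prod_lower (d : ℝ) (hd : 0 ≤ d) (z : ℂ) (s : Multiset ℂ) (h : ∀ r ∈ s, d ≤ ‖z - r‖) :
    d ^ s.card ≤ ‖(s.map (fun r => z - r)).prod‖ := by
  induction s using Multiset.induction_on with
  | empty => simp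
  | cons a s ih =>
    have h1 := h a (Multiset.mem_cons_self a s)
    have h2 := ih (fun r hr => h r (Multiset.mem_cons_of_mem hr))
    rw [Multiset.map_cons, Multiset.prod_cons, norm_mul, Multiset.card_cons, pow_succ, mul_comm]
    exact mul_le_mul h1 h2 (by positivity) (norm_nonneg _)

theorem redPoly_small : ‖redPoly.eval (⟨94995902778636324581039730/10^26, 75007852593288994924968318/10^26⟩ : ℂ)‖ < 6880440 * (1/25)^14 := by
  have hmul : ∀ a b c d : ℝ, (⟨a, b⟩ : ℂ) * ⟨c, d⟩ = ⟨a*c - b*d, a*d + b*c⟩ := fun _ _ _ _ => by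
    apply Complex.ext <;> simp
  have hadd : ∀ a b c d : ℝ, (⟨a, b⟩ : ℂ) + ⟨c, d⟩ = ⟨a+c, b+d⟩ := fun _ _ _ _ => by
    apply Complex.ext <;> simp
  have key : ∀ z : ℂ, redPoly.eval z = (((((((⟨6880440,0⟩) * (z*z) + ⟨39605356,0⟩) * (z*z) + ⟨117182520,0⟩) * (z*z) + ⟨237218982,0⟩) * (z*z) + ⟨367407040,0⟩) * (z*z) + ⟨454603968,0⟩) * (z*z) + ⟨435456000,0⟩) * (z*z) + ⟨257184319,0⟩ := by
    intro z
    rw [redPoly_eval]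
    have hc : ∀ a : ℝ, (⟨a, 0⟩ : ℂ) = (a : ℂ) := fun a => rfl
    simp only [hc]
    push_cast
    ring
  rw [key]
  simp only [hmul, hadd]
  apply lt_of_pow_lt_pow_left₀ 2 (by positivity)
  rw [← Complex.normSq_eq_norm_sq, Complex.normSq_mk]
  norm_num

theorem exists_root_s12 : ∃ t : ℂ, redPoly.eval t = 0 ∧ (10 / 11 : ℝ) < t.re := by
  by_contra hcon
  push Not at hcon
  have hs := IsAlgClosed.splits redPoly
  have hcard : redPoly.roots.card = 14 := by
    rw [← hs.natDegree_eq_card_roots, redPoly_natDegree]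
  have hev := hs.eval_eq_prod_roots (⟨94995902778636324581039730/10^26, 75007852593288994924968318/10^26⟩ : ℂ)
  have hlow := prod_lower (1/25) (by norm_num) (⟨94995902778636324581039730/10^26, 75007852593288994924968318/10^26⟩ : ℂ) redPoly.roots (by
    intro r hr
    have h0 : redPoly.eval r = 0 := (Polynomial.mem_roots'.1 hr).2
    have h1 := hcon r h0
    refine le_trans ?_ (Complex.re_le_norm _)
    rw [Complex.sub_re]
    have : (1/25 : ℝ) ≤ 94995902778636324581039730/10^26 - 10/11 := by norm_num
    dsimp only
    linarith)
  have hsm := redPoly_small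
  rw [hev, redPoly_lc, norm_mul] at hsm
  rw [hcard] at hlow
  have h3 : ‖(6880440 : ℂ)‖ = 6880440 := by simp
  rw [h3] at hsm
  linarith

theorem genus_eight_violates_narrow_canonical_strip :
    ∃ z : ℂ, Q 8 z = 0 ∧ (-1 / 11 : ℝ) < z.re := by
  obtain ⟨t, ht, hre⟩ := exists_root_s12
  rw [redPoly_eval] at ht
  refine ⟨t - 1, ?_, by rw [Complex.sub_re, Complex.one_re]; linarith⟩
  have hdet : (verlindeMatrix 8 (t - 1)).det = 0 := by
    rw [← Matrix.exists_mulVec_eq_zero_iff]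
    refine ⟨![((-609638400) + (-921649536)*t^2 + (-856331840)*t^4 + (-613917304)*t^6 + (-350434656)*t^8 + (-152523280)*t^10 + (-45263264)*t^12 + (-6880440)*t^14),
      ((460824768) + (611665600)*t^2 + (485192708)*t^4 + (285130560)*t^6 + (125092968)*t^8 + (37200800)*t^10 + (5657908)*t^12),
      ((-122333120) + (-138626488)*t^2 + (-90138048)*t^4 + (-40712672)*t^6 + (-12204192)*t^8 + (-1860040)*t^10),
      ((14852838) + (13796640)*t^2 + (6894888)*t^4 + (2127840)*t^6 + (326898)*t^8),
      ((-919776) + (-656656)*t^2 + (-224224)*t^4 + (-35464)*t^6),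
      ((29848) + (14560)*t^2 + (2548)*t^4),
      ((-480) + (-120)*t^2),
      ((3))], ?_, ?_⟩
    · intro h
      have := congrFun h 7
      simp at this
    · funext r
      fin_cases r
      · simp [Matrix.mulVec, dotProduct, Fin.sum_univ_eight, verlindeMatrix]
        linear_combination -ht
      all_goals
        simp [Matrix.mulVec, dotProduct, Fin.sum_univ_eight, verlindeMatrix]
        ring
  rw [Q, hdet]
  simp
end
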